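/- Let p and q be real-rooted real polynomials, both of degree exactly n ≥ 2. Then mesh(p ⊞_n q) ≥ mesh(p). -/

import Mathlib

open Polynomial

/-- Generalized hypergeometric polynomial in standard normalization:
`₍i+1₎𝓕_j(-n, a; b; x) = Σ_{k=0}^n (-n)_k (a)_k (b+k)_{n-k} x^k / k!`. -/
noncomputable def hyp (n : ℕ) {i j : ℕ} (a : Fin i → ℝ) (b : Fin j → ℝ) : Polynomial ℝ :=
  ∑ k ∈ Finset.range (n + 1),
    Polynomial.C (((ascPochhammer ℝ k).eval (-(n : ℝ)) *
        (∏ s, (ascPochhammer ℝ k).eval (a s)) *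
        (∏ s, (ascPochhammer ℝ (n - k)).eval (b s + (k : ℝ)))) / (Nat.factorial k : ℝ)) *
      Polynomial.X ^ k

/-- The coefficient `e_k(p)` in the representation `p(x) = Σ_{k=0}^n (-1)^k e_k(p) x^{n-k}`. -/
def eCoeff (n k : ℕ) (p : Polynomial ℝ) : ℝ := (-1 : ℝ) ^ k * p.coeff (n - k)

/-- Finite free multiplicative convolution `p ⊠_n q`. -/
noncomputable def ffMul (n : ℕ) (p q : Polynomial ℝ) : Polynomial ℝ :=
  ∑ k ∈ Finset.range (n + 1),
    Polynomial.C ((-1 : ℝ) ^ k * ((n.choose k : ℝ))⁻¹ * eCoeff n k p * eCoeff n k q) *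
      Polynomial.X ^ (n - k)

/-- Finite free additive convolution `p ⊞_n q`. -/
noncomputable def ffAdd (n : ℕ) (p q : Polynomial ℝ) : Polynomial ℝ :=
  ∑ k ∈ Finset.range (n + 1),
    Polynomial.C ((-1 : ℝ) ^ k *
      ∑ l ∈ Finset.range (k + 1),
        (((n - l).factorial : ℝ) * ((n - (k - l)).factorial : ℝ)) /
            ((n.factorial : ℝ) * ((n - k).factorial : ℝ)) *
          eCoeff n l p * eCoeff n (k - l) q) *
      Polynomial.X ^ (n - k)

/-- A real polynomial is real-rooted if all of its complex roots are real, i.e. the number of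
real roots counted with multiplicity equals the degree. -/
def RealRooted (p : Polynomial ℝ) : Prop := p.roots.card = p.natDegree

/-- The real roots of `p`, with multiplicity, sorted in increasing order. -/
noncomputable def sroots (p : Polynomial ℝ) : List ℝ := p.roots.sort (· ≤ ·)

/-- `p ⪯ q`: `p` and `q` are real-rooted of degree `n` and
`λ_1(p) ≤ λ_1(q) ≤ λ_2(p) ≤ … ≤ λ_n(p) ≤ λ_n(q)` (roots in increasing order). -/
noncomputable def Interlaces (n : ℕ) (p q : Polynomial ℝ) : Prop :=
  RealRooted p ∧ RealRooted q ∧ p.natDegree = n ∧ q.natDegree = n ∧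
  (∀ k, k < n → (sroots p).getD k 0 ≤ (sroots q).getD k 0) ∧
  (∀ k, k + 1 < n → (sroots q).getD k 0 ≤ (sroots p).getD (k + 1) 0)

/-- `p ≺ q`: strict interlacing. -/
noncomputable def StrictInterlaces (n : ℕ) (p q : Polynomial ℝ) : Prop :=
  RealRooted p ∧ RealRooted q ∧ p.natDegree = n ∧ q.natDegree = n ∧
  (∀ k, k < n → (sroots p).getD k 0 < (sroots q).getD k 0) ∧
  (∀ k, k + 1 < n → (sroots q).getD k 0 < (sroots p).getD (k + 1) 0)

/-- The mesh (minimal distance between roots) of a real-rooted polynomial with `n` roots. -/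
noncomputable def mesh (n : ℕ) (p : Polynomial ℝ) : ℝ :=
  sInf {d : ℝ | ∃ k l : ℕ, k < l ∧ l < n ∧
    d = |(sroots p).getD k 0 - (sroots p).getD l 0|}

/-- The logarithmic mesh (minimal ratio between consecutive decreasingly ordered roots) of a
polynomial with `n` positive roots. -/
noncomputable def lmesh (n : ℕ) (p : Polynomial ℝ) : ℝ :=
  sInf {d : ℝ | ∃ k : ℕ, k + 1 < n ∧
    d = (sroots p).getD (k + 1) 0 / (sroots p).getD k 0}

/-- Generalized Laguerre polynomial `L_n^{(α)}`. -/
noncomputable def Laguerre (n : ℕ) (α : ℝ) : Polynomial ℝ :=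
  ∑ k ∈ Finset.range (n + 1),
    Polynomial.C ((descPochhammer ℝ (n - k)).eval ((n : ℝ) + α) /
        ((k.factorial : ℝ) * ((n - k).factorial : ℝ)) * (-1 : ℝ) ^ k) *
      Polynomial.X ^ k

/-- The apolar pairing. -/
noncomputable def BB (n : ℕ) (f r : ℂ[X]) : ℂ :=
  ∑ m ∈ Finset.range (n + 1), (m.factorial : ℂ) * ((n - m).factorial : ℂ) * f.coeff m * r.coeff (n - m)

/-- Polar derivative. -/
noncomputable def polar (n : ℕ) (b : ℝ) (f : ℂ[X]) : ℂ[X] :=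
  C ((n : ℂ) + 1) * f - C (b : ℂ) * derivative f - X * derivative f

lemma coeff_polar (n : ℕ) (b : ℝ) (f : ℂ[X]) (m : ℕ) :
    (polar n b f).coeff m = ((n : ℂ) + 1 - m) * f.coeff m - b * (m + 1) * f.coeff (m + 1) := by
  unfold polar
  cases m with
  | zero => simp [coeff_derivative]
  | succ m =>
    simp only [coeff_sub, coeff_C_mul, coeff_X_mul, coeff_derivative]
    push_cast
    ring

lemma BB_step (n : ℕ) (f r : ℂ[X]) (b : ℝ) (hr : r.natDegree ≤ n) :
    BB (n + 1) f ((X - C (b : ℂ)) * r) = BB n (polar n b f) r := by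
  unfold BB
  have hz : r.coeff (n + 1) = 0 := coeff_eq_zero_of_natDegree_lt (by omega)
  have e1 : ∀ m ∈ Finset.range (n + 1),
      (m.factorial : ℂ) * ((n - m).factorial : ℂ) * (polar n b f).coeff m * r.coeff (n - m)
      = (m.factorial : ℂ) * ((n + 1 - m).factorial : ℂ) * f.coeff m * r.coeff (n - m)
        - b * (((m + 1).factorial : ℂ) * ((n + 1 - (m + 1)).factorial : ℂ) * f.coeff (m + 1)
          * r.coeff (n + 1 - (m + 1))) := by
    intro m hm
    have hm' : m ≤ n := by simpa [Nat.lt_succ_iff] using hm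
    obtain ⟨k, rfl⟩ := Nat.exists_eq_add_of_le hm'
    have h1 : m + k - m = k := by omega
    have h2 : m + k + 1 - m = k + 1 := by omega
    have h3 : m + k + 1 - (m + 1) = k := by omega
    rw [coeff_polar, h1, h2, h3, Nat.factorial_succ, Nat.factorial_succ]
    push_cast
    ring
  rw [Finset.sum_congr rfl e1, Finset.sum_sub_distrib, ← Finset.mul_sum]
  have e2 : ∀ m ∈ Finset.range (n + 1 + 1),
      (m.factorial : ℂ) * ((n + 1 - m).factorial : ℂ) * f.coeff m
        * ((X - C (b : ℂ)) * r).coeff (n + 1 - m)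
      = (m.factorial : ℂ) * ((n + 1 - m).factorial : ℂ) * f.coeff m * (X * r).coeff (n + 1 - m)
        - b * ((m.factorial : ℂ) * ((n + 1 - m).factorial : ℂ) * f.coeff m
          * r.coeff (n + 1 - m)) := by
    intro m _
    rw [sub_mul, coeff_sub, coeff_C_mul]
    ring
  rw [Finset.sum_congr rfl e2, Finset.sum_sub_distrib, ← Finset.mul_sum]
  congr 1
  · rw [Finset.sum_range_succ]
    have : n + 1 - (n + 1) = 0 := by omega
    rw [this, coeff_X_mul_zero, mul_zero, add_zero]
    refine Finset.sum_congr rfl fun m hm => ?_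
    have hm' : m ≤ n := by simpa [Nat.lt_succ_iff] using hm
    have : n + 1 - m = (n - m) + 1 := by omega
    rw [this, coeff_X_mul]
  · rw [Finset.sum_range_succ']
    simp [hz]

lemma im_lt_of_root {f : ℂ[X]} (hs : ∀ z : ℂ, 0 ≤ z.im → f.eval z ≠ 0) :
    ∀ a ∈ f.roots, a.im < 0 := by
  intro a ha
  by_contra h
  exact hs a (not_lt.mp h) (isRoot_of_mem_roots ha)

lemma polar_natDegree (n : ℕ) (b : ℝ) (f : ℂ[X]) (hf : f.natDegree = n + 1)
    (hs : ∀ z : ℂ, 0 ≤ z.im → f.eval z ≠ 0) : (polar n b f).natDegree = n := by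
  have hspl : f.Splits := IsAlgClosed.splits f
  have hlc : f.coeff (n + 1) = f.leadingCoeff := by rw [leadingCoeff, hf]
  have hlc0 : f.leadingCoeff ≠ 0 := by
    rw [Ne, leadingCoeff_eq_zero]; rintro rfl; simp at hf
  have hcard : f.roots.card = n + 1 := by rw [← hspl.natDegree_eq_card_roots, hf]
  apply le_antisymm
  · rw [natDegree_le_iff_coeff_eq_zero]
    intro m hm
    rw [coeff_polar, coeff_eq_zero_of_natDegree_lt (by omega : f.natDegree < m + 1)]
    rcases eq_or_lt_of_le (Nat.succ_le_of_lt hm) with h | h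
    · subst h; push_cast; simp
    · rw [coeff_eq_zero_of_natDegree_lt (by omega)]; simp
  · apply le_natDegree_of_ne_zero
    rw [coeff_polar]
    have hnc := hspl.nextCoeff_eq_neg_sum_roots_mul_leadingCoeff
    rw [nextCoeff_of_natDegree_pos (by omega), hf, Nat.add_sub_cancel] at hnc
    rw [hnc, hlc]
    have : ((n : ℂ) + 1 - n) * (-f.leadingCoeff * f.roots.sum) - b * (n + 1) * f.leadingCoeff
      = -f.leadingCoeff * (f.roots.sum + b * (n + 1)) := by ring
    rw [this]
    refine mul_ne_zero (neg_ne_zero.mpr hlc0) fun h0 => ?_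
    have him := congrArg Complex.imAddGroupHom h0
    rw [map_add, map_multiset_sum] at him
    have hlt : (f.roots.map Complex.imAddGroupHom).sum < 0 := by
      have := Multiset.sum_lt_sum_of_nonempty (s := f.roots) (f := Complex.imAddGroupHom)
        (g := fun _ => (0 : ℝ)) (by intro h; rw [h] at hcard; simp at hcard)
        (fun a ha => im_lt_of_root hs a ha)
      simpa using this
    have : Complex.imAddGroupHom ((b : ℂ) * (n + 1)) = 0 := by simp
    rw [this] at him
    simp only [map_zero, add_zero] at him
    linarith

lemma polar_ne (n : ℕ) (b : ℝ) (f : ℂ[X]) (hf : f.natDegree = n + 1)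
    (hs : ∀ z : ℂ, 0 ≤ z.im → f.eval z ≠ 0) (z : ℂ) (hz : 0 ≤ z.im) :
    (polar n b f).eval z ≠ 0 := by
  intro h0
  have hspl : f.Splits := IsAlgClosed.splits f
  have hcard : f.roots.card = n + 1 := by rw [← hspl.natDegree_eq_card_roots, hf]
  have hfz := hs z hz
  have hd := hspl.eval_derivative_div_eval_of_ne_zero hfz
  have h1 : ((n : ℂ) + 1) * f.eval z = (z + b) * (derivative f).eval z := by
    unfold polar at h0
    simp at h0
    linear_combination h0
  have hzb : z + b ≠ 0 := by
    intro h
    rw [h, zero_mul] at h1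
    exact (mul_ne_zero (Nat.cast_add_one_ne_zero n) hfz) h1
  set v : ℂ := 1 / (z + b) with hv
  have h2 : (f.roots.map fun a => 1 / (z - a)).sum = ((n : ℂ) + 1) * v := by
    rw [← hd, hv]
    field_simp
    linear_combination -h1
  -- linear functional
  let L : ℂ →+ ℝ :=
    { toFun := fun u => 2 * z.im * (v.re * u.re + v.im * u.im) + u.im
      map_zero' := by simp
      map_add' := by intro x y; simp; ring }
  have hLdef : ∀ u, L u = 2 * z.im * (v.re * u.re + v.im * u.im) + u.im := fun u => rfl
  have key : ∀ a ∈ f.roots, L (1 / (z - a)) < L v := by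
    intro a ha
    have ha' := im_lt_of_root hs a ha
    have hu : z.im * Complex.normSq (1 / (z - a)) + (1 / (z - a)).im < 0 := by
      have hne : z - a ≠ 0 := by
        intro h
        have := congrArg Complex.im h
        simp at this
        linarith
      have hpos := Complex.normSq_pos.mpr hne
      rw [one_div, Complex.normSq_inv, Complex.inv_im, Complex.sub_im]
      have : z.im * (Complex.normSq (z - a))⁻¹ + -(z.im - a.im) / Complex.normSq (z - a)
        = a.im / Complex.normSq (z - a) := by field_simp; ring
      rw [this]
      exact div_neg_of_neg_of_pos ha' hpos
    have hw : z.im * Complex.normSq v + v.im = 0 := by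
      have hpos := Complex.normSq_pos.mpr hzb
      rw [hv, one_div, Complex.normSq_inv, Complex.inv_im, Complex.add_im, Complex.ofReal_im]
      field_simp
      ring
    rw [hLdef, hLdef]
    generalize (1 / (z - a)) = u at *
    rw [Complex.normSq_apply] at hu hw
    nlinarith [mul_nonneg hz (sq_nonneg (u.re - v.re)), mul_nonneg hz (sq_nonneg (u.im - v.im))]
  have hlt := Multiset.sum_lt_sum_of_nonempty (s := f.roots) (f := fun a => L (1 / (z - a)))
        (g := fun _ => L v) (by intro h; rw [h] at hcard; simp at hcard) key
  have h3 := congrArg L h2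
  rw [map_multiset_sum, Multiset.map_map] at h3
  have h4 : L (((n : ℂ) + 1) * v) = (n + 1) * L v := by
    rw [hLdef, hLdef]; simp; ring
  rw [h4] at h3
  simp only [Multiset.map_const', Multiset.sum_replicate, hcard, nsmul_eq_mul] at hlt
  simp only [Function.comp_def] at h3
  push_cast at hlt
  linarith

lemma grace (s : Multiset ℝ) : ∀ (f : ℂ[X]), f.natDegree = s.card →
    (∀ z : ℂ, 0 ≤ z.im → f.eval z ≠ 0) →
    BB s.card f (s.map fun b : ℝ => X - C (b : ℂ)).prod ≠ 0 := by
  induction s using Multiset.induction with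
  | empty =>
    intro f hf hs
    have := hs 0 (by simp)
    rw [Multiset.card_zero] at hf
    rw [eq_C_of_natDegree_eq_zero hf] at this
    simpa [BB] using this
  | cons b s ih =>
    intro f hf hs
    rw [Multiset.card_cons] at hf ⊢
    rw [Multiset.map_cons, Multiset.prod_cons, BB_step]
    · exact ih _ (polar_natDegree _ b f hf hs) (polar_ne _ b f hf hs)
    · have : (s.map fun b : ℝ => (X - C (b : ℂ))) = (s.map (fun b : ℝ => (b : ℂ))).map fun b => X - C b := by
        rw [Multiset.map_map]; rfl
      rw [this, natDegree_multiset_prod_X_sub_C_eq_card]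
      simp

/-- The convolution as a differential operator. -/
noncomputable def Phi (n : ℕ) (q f : ℝ[X]) : ℝ[X] :=
  ∑ m ∈ Finset.range (n + 1), C (((n - m).factorial : ℝ) * q.coeff (n - m)) * derivative^[m] f

lemma ffAdd_eq_Phi (n : ℕ) (p q : ℝ[X]) (hp : p.natDegree = n) :
    C (n.factorial : ℝ) * ffAdd n p q = Phi n q p := by
  ext d
  rw [coeff_C_mul]
  unfold ffAdd Phi
  rw [finsetSum_coeff, finsetSum_coeff]
  simp only [coeff_C_mul, coeff_X_pow, coeff_iterate_derivative, nsmul_eq_mul]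
  by_cases hd : d ≤ n
  · obtain ⟨k, rfl⟩ := Nat.exists_eq_add_of_le hd
    rw [Finset.sum_eq_single k]
    · have e : d + k - k = d := by omega
      rw [if_pos (by omega), mul_one, ← Finset.sum_flip, e,
        show d + k + 1 = (k + 1) + d by ring, Finset.sum_range_add _ (k + 1) d]
      have hz : ∑ x ∈ Finset.range d, ((d + k - (k + 1 + x)).factorial : ℝ) *
          q.coeff (d + k - (k + 1 + x)) *
          (((d + (k + 1 + x)).descFactorial (k + 1 + x) : ℕ) * p.coeff (d + (k + 1 + x))) = 0 := by
        refine Finset.sum_eq_zero fun x _ => ?_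
        rw [coeff_eq_zero_of_natDegree_lt (p := p) (by omega)]
        simp
      rw [hz, add_zero, Finset.mul_sum, Finset.mul_sum]
      refine Finset.sum_congr rfl fun m hm => ?_
      have hm' : m ≤ k := by simpa [Nat.lt_succ_iff] using hm
      obtain ⟨j, rfl⟩ := Nat.exists_eq_add_of_le hm'
      unfold eCoeff
      have e1 : m + j - m = j := by omega
      have e2 : d + (m + j) - j = d + m := by omega
      have e3 : m + j - j = m := by omega
      rw [e1, e2, e3]
      have hdf : ((d.factorial : ℕ) : ℝ) * ((d + m).descFactorial m : ℕ) = ((d + m).factorial : ℕ) := by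
        rw [← Nat.cast_mul]
        congr 1
        have := Nat.factorial_mul_descFactorial (n := d + m) (k := m) (by omega)
        rwa [Nat.add_sub_cancel] at this
      have h0 : ((d.factorial : ℕ) : ℝ) ≠ 0 := by positivity
      have h1 : (((d + (m + j)).factorial : ℕ) : ℝ) ≠ 0 := by positivity
      have hs : (-1 : ℝ) ^ (m + j) * ((-1) ^ j * (-1) ^ m) = 1 := by
        rw [pow_add, show (-1 : ℝ) ^ m * (-1) ^ j * ((-1) ^ j * (-1) ^ m)
          = ((-1) ^ j * (-1) ^ j) * ((-1) ^ m * (-1) ^ m) by ring, ← mul_pow, ← mul_pow]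
        norm_num
      rw [← hdf]
      field_simp
      have e4 : d + (m + j) - m = d + j := by omega
      rw [e4]
      linear_combination (p.coeff (d + m) * q.coeff (d + j)) * hs
    · intro b hb hne
      rw [Finset.mem_range] at hb
      rw [if_neg (by omega), mul_zero]
    · simp
  · rw [Finset.sum_eq_zero, Finset.sum_eq_zero, mul_zero]
    · intro m _
      rw [coeff_eq_zero_of_natDegree_lt (p := p) (by omega)]
      simp
    · intro k _
      rw [if_neg (by omega), mul_zero]

lemma Phi_add (n : ℕ) (q f g : ℝ[X]) : Phi n q (f + g) = Phi n q f + Phi n q g := by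
  simp [Phi, mul_add, Finset.sum_add_distrib]

lemma Phi_C_mul (n : ℕ) (q f : ℝ[X]) (a : ℝ) : Phi n q (C a * f) = C a * Phi n q f := by
  simp only [Phi, iterate_derivative_C_mul, Finset.mul_sum]
  refine Finset.sum_congr rfl fun m _ => by ring

lemma Phi_derivative (n : ℕ) (q f : ℝ[X]) : Phi n q (derivative f) = derivative (Phi n q f) := by
  simp only [Phi, derivative_sum, derivative_C_mul, ← Function.iterate_succ_apply',
    ← Function.iterate_succ_apply]

lemma iter_deriv_comp (m : ℕ) (t : ℝ) (f : ℝ[X]) :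
    derivative^[m] (taylor t f) = taylor t (derivative^[m] f) := by
  induction m with
  | zero => rfl
  | succ m ih =>
    rw [Function.iterate_succ_apply', Function.iterate_succ_apply', ih]
    simp [taylor_apply, derivative_comp]

lemma Phi_taylor (n : ℕ) (q f : ℝ[X]) (t : ℝ) : Phi n q (taylor t f) = taylor t (Phi n q f) := by
  simp only [Phi, iter_deriv_comp, map_sum, taylor_mul, taylor_C]

lemma Phi_eval (n : ℕ) (q f : ℝ[X]) (z : ℂ) :
    ((Phi n q f).map Complex.ofRealHom).eval z
      = BB n (taylor z (f.map Complex.ofRealHom)) (q.map Complex.ofRealHom) := by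
  unfold Phi BB
  rw [Polynomial.map_sum, eval_finsetSum]
  refine Finset.sum_congr rfl fun m _ => ?_
  rw [Polynomial.map_mul, map_C, eval_mul, eval_C, ← iterate_derivative_map,
    ← factorial_smul_hasseDeriv, taylor_coeff, coeff_map]
  simp
  ring

lemma BB_ne (n : ℕ) (q : ℝ[X]) (hq : RealRooted q) (hqd : q.natDegree = n) (hn : 2 ≤ n) (f : ℂ[X])
    (hf : f.natDegree = n) (hs : ∀ z : ℂ, 0 ≤ z.im → f.eval z ≠ 0) :
    BB n f (q.map Complex.ofRealHom) ≠ 0 := by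
  have hq0 : q.leadingCoeff ≠ 0 := by
    rw [Ne, leadingCoeff_eq_zero]; rintro rfl; simp at hqd; omega
  have hc : q.roots.card = n := by rw [← hqd]; exact hq
  have e : q.map Complex.ofRealHom
      = C (q.leadingCoeff : ℂ) * (q.roots.map fun b : ℝ => X - C (b : ℂ)).prod := by
    conv_lhs => rw [← C_leadingCoeff_mul_prod_multiset_X_sub_C hq]
    rw [Polynomial.map_mul, Polynomial.map_multiset_prod, Multiset.map_map, map_C]
    simp
  have h := grace q.roots f (by rw [hf, hc]) hs
  rw [hc] at h
  have e2 : BB n f (q.map Complex.ofRealHom) = (q.leadingCoeff : ℂ) *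
      BB n f (q.roots.map fun b : ℝ => X - C (b : ℂ)).prod := by
    rw [e]
    simp only [BB, coeff_C_mul, Finset.mul_sum]
    refine Finset.sum_congr rfl fun m _ => by ring
  rw [e2]
  exact mul_ne_zero (by exact_mod_cast hq0) h

lemma no_common (n : ℕ) (q : ℝ[X]) (hq : RealRooted q) (hqd : q.natDegree = n) (hn : 2 ≤ n)
    (p g : ℝ[X]) (hp : p.natDegree = n) (hg : g.natDegree < n)
    (hs : ∀ z : ℂ, 0 ≤ z.im →
      (p.map Complex.ofRealHom + C Complex.I * g.map Complex.ofRealHom).eval z ≠ 0)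
    (x : ℝ) (h1 : (Phi n q p).eval x = 0) (h2 : (Phi n q g).eval x = 0) : False := by
  set F := p.map Complex.ofRealHom + C Complex.I * g.map Complex.ofRealHom with hF
  have hFd : F.natDegree = n := by
    rw [hF, natDegree_add_eq_left_of_natDegree_lt]
    · rw [natDegree_map, hp]
    · rw [natDegree_C_mul Complex.I_ne_zero, natDegree_map, natDegree_map, hp]; exact hg
  apply BB_ne n q hq hqd hn (taylor (x : ℂ) F) (by rw [natDegree_taylor, hFd])
  · intro z hz
    rw [taylor_eval]
    exact hs _ (by simpa using hz)
  · have e : BB n (taylor (x : ℂ) F) (q.map Complex.ofRealHom)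
        = ((Phi n q p).map Complex.ofRealHom).eval (x : ℂ)
          + Complex.I * ((Phi n q g).map Complex.ofRealHom).eval (x : ℂ) := by
      rw [Phi_eval, Phi_eval]
      simp only [BB, hF, map_add, taylor_mul, taylor_C, coeff_add, coeff_C_mul, Finset.mul_sum,
        ← Finset.sum_add_distrib]
      refine Finset.sum_congr rfl fun m _ => by ring
    have c : ∀ P : ℝ[X], P.eval x = 0 → (P.map Complex.ofRealHom).eval (x : ℂ) = 0 := by
      intro P hP
      have := eval_map_apply (p := P) (f := Complex.ofRealHom) x
      rw [hP] at this
      simpa using this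
    rw [e, c _ h1, c _ h2]
    simp

lemma Phi_natDegree (n : ℕ) (q f : ℝ[X]) (hq : q.natDegree = n) (hf : f.natDegree = n)
    (hn : 2 ≤ n) : (Phi n q f).natDegree = n := by
  apply le_antisymm
  · unfold Phi
    apply natDegree_sum_le_of_forall_le
    intro m _
    refine (natDegree_C_mul_le _ _).trans ((natDegree_iterate_derivative _ _).trans ?_)
    omega
  · apply le_natDegree_of_ne_zero
    unfold Phi
    rw [finsetSum_coeff, Finset.sum_eq_single 0]
    · have h1 : q.coeff n ≠ 0 := by
        rw [← hq, coeff_natDegree, Ne, leadingCoeff_eq_zero]; rintro rfl; simp at hq; omega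
      have h2 : f.coeff n ≠ 0 := by
        rw [← hf, coeff_natDegree, Ne, leadingCoeff_eq_zero]; rintro rfl; simp at hf; omega
      rw [coeff_C_mul]; simp [h1, h2, Nat.factorial_ne_zero]
    · intro m _ hm
      rw [coeff_C_mul, coeff_iterate_derivative, coeff_eq_zero_of_natDegree_lt (p := f) (by omega)]
      simp
    · simp

lemma Phi_realRooted (n : ℕ) (q p : ℝ[X]) (hq : RealRooted q) (hqd : q.natDegree = n) (hn : 2 ≤ n)
    (hp : RealRooted p) (hpd : p.natDegree = n) : RealRooted (Phi n q p) := by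
  have hp0 : p ≠ 0 := by rintro rfl; simp at hpd; omega
  have hspl : p.Splits := splits_iff_card_roots.mpr hp
  have up : ∀ z : ℂ, 0 < z.im → ((Phi n q p).map Complex.ofRealHom).eval z ≠ 0 := by
    intro z hz
    rw [Phi_eval]
    apply BB_ne n q hq hqd hn _ (by rw [natDegree_taylor, natDegree_map, hpd])
    intro w hw h
    rw [taylor_eval] at h
    obtain ⟨x, hx⟩ := hspl.mem_range_of_isRoot hp0 h
    have := congrArg Complex.im hx
    simp at this
    linarith
  unfold RealRooted
  rw [← splits_iff_card_roots]
  refine Splits.of_splits_map Complex.ofRealHom (IsAlgClosed.splits _) ?_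
  intro a ha
  have ha := isRoot_of_mem_roots ha
  have him : a.im = 0 := by
    rcases lt_trichotomy a.im 0 with h | h | h
    · exfalso
      apply up (starRingEnd ℂ a) (by simpa using h)
      have e : ((Phi n q p).map Complex.ofRealHom).map (starRingEnd ℂ)
          = (Phi n q p).map Complex.ofRealHom := by
        rw [Polynomial.map_map]
        congr 1
        ext x
        simp
      rw [← e, eval_map_apply, ha.eq_zero, map_zero]
    · exact h
    · exact absurd ha.eq_zero (up a h)
  exact ⟨a.re, by apply Complex.ext <;> simp [him]⟩

lemma stable (S : Finset ℝ) (c : ℝ → ℝ) (hc : ∀ a ∈ S, 0 < c a) (z : ℂ) (hz : 0 ≤ z.im) :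
    ((∏ a ∈ S, (X - C a) : ℝ[X]).map Complex.ofRealHom + C Complex.I *
      (∑ a ∈ S, C (c a) * ∏ b ∈ S.erase a, (X - C b) : ℝ[X]).map Complex.ofRealHom).eval z ≠ 0 := by
  rw [eval_add, eval_mul, eval_C, Polynomial.map_prod, Polynomial.map_sum, eval_prod,
    eval_finsetSum]
  simp only [Polynomial.map_mul, Polynomial.map_prod, Polynomial.map_sub, map_X, map_C, eval_mul,
    eval_prod, eval_sub, eval_X, eval_C, Complex.ofRealHom_eq_coe]
  by_cases h : ∏ a ∈ S, (z - (a : ℂ)) = 0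
  · rw [h, zero_add]
    obtain ⟨a, ha, h0⟩ := Finset.prod_eq_zero_iff.mp h
    obtain rfl : z = a := sub_eq_zero.mp h0
    refine mul_ne_zero Complex.I_ne_zero ?_
    rw [Finset.sum_eq_single a]
    · refine mul_ne_zero (by exact_mod_cast (hc a ha).ne') ?_
      rw [Finset.prod_ne_zero_iff]
      intro b hb h
      have := sub_eq_zero.mp h
      exact (Finset.ne_of_mem_erase hb) (by exact_mod_cast this.symm)
    · intro b hb hba
      rw [Finset.prod_eq_zero (i := a) (Finset.mem_erase.mpr ⟨hba.symm, ha⟩) (by simp), mul_zero]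
    · exact fun h => absurd ha h
  · have hne : ∀ a ∈ S, z - (a : ℂ) ≠ 0 := by
      intro a ha h0
      exact h (Finset.prod_eq_zero ha h0)
    have e : ∑ a ∈ S, (c a : ℂ) * ∏ b ∈ S.erase a, (z - (b : ℂ))
        = (∏ a ∈ S, (z - (a : ℂ))) * ∑ a ∈ S, (c a : ℂ) * (z - a)⁻¹ := by
      rw [Finset.mul_sum]
      refine Finset.sum_congr rfl fun a ha => ?_
      rw [← Finset.mul_prod_erase S _ ha]
      have := hne a ha
      field_simp
    rw [e]
    intro h0
    have h1 : 1 + Complex.I * ∑ a ∈ S, (c a : ℂ) * (z - a)⁻¹ = 0 := by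
      apply mul_left_cancel₀ h
      linear_combination h0
    have h2 := congrArg Complex.re h1
    have h3 : (∑ a ∈ S, (c a : ℂ) * (z - a)⁻¹).im ≤ 0 := by
      rw [Complex.im_sum]
      refine Finset.sum_nonpos fun a ha => ?_
      rw [Complex.im_ofReal_mul, Complex.inv_im]
      refine mul_nonpos_of_nonneg_of_nonpos (hc a ha).le ?_
      refine div_nonpos_of_nonpos_of_nonneg ?_ (Complex.normSq_nonneg _)
      simpa using hz
    rw [Complex.add_re, Complex.I_mul_re] at h2
    simp at h2 h3
    linarith

lemma natDegree_g (S : Finset ℝ) (c : ℝ → ℝ) (h : 2 ≤ S.card) :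
    (∑ a ∈ S, C (c a) * ∏ b ∈ S.erase a, (X - C b) : ℝ[X]).natDegree < S.card := by
  have : (∑ a ∈ S, C (c a) * ∏ b ∈ S.erase a, (X - C b) : ℝ[X]).natDegree ≤ S.card - 1 := by
    apply natDegree_sum_le_of_forall_le
    intro a ha
    refine (natDegree_C_mul_le _ _).trans ?_
    rw [natDegree_prod _ _ (fun b _ => X_sub_C_ne_zero b)]
    simp [Finset.card_erase_of_mem ha]
  omega

lemma diff_eq (S : Finset ℝ) (d t : ℝ) (ht : 0 < t) (htd : t < d) (h2 : 2 ≤ S.card)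
    (hS : ∀ a ∈ S, ∀ b ∈ S, a ≠ b → d ≤ |a - b|) :
    ∃ c : ℝ → ℝ, (∀ a ∈ S, 0 < c a) ∧
      (∏ a ∈ S, (X - C a) : ℝ[X]) - taylor (-t) (∏ a ∈ S, (X - C a))
        = ∑ a ∈ S, C (c a) * ∏ b ∈ S.erase a, (X - C b) := by
  refine ⟨fun a => t * ∏ b ∈ S.erase a, ((a - t - b) / (a - b)), ?_, ?_⟩
  · intro a ha
    refine mul_pos ht (Finset.prod_pos fun b hb => ?_)
    have hb' := Finset.mem_erase.mp hb
    have h := hS a ha b hb'.2 hb'.1.symm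
    rcases lt_or_gt_of_ne hb'.1 with hlt | hlt
    · rw [abs_of_pos (by linarith)] at h
      exact div_pos (by linarith) (by linarith)
    · exact div_pos_of_neg_of_neg (by linarith) (by linarith)
  · have hmon : (∏ a ∈ S, (X - C a) : ℝ[X]).Monic := monic_prod_of_monic _ _ fun a _ => monic_X_sub_C a
    have hdeg : (∏ a ∈ S, (X - C a) : ℝ[X]).degree = S.card := by
      rw [degree_prod]; simp
    apply eq_of_degrees_lt_of_eval_finset_eq S
    · rw [← hdeg]
      apply degree_sub_lt_left _ hmon.ne_zero
      · rw [leadingCoeff_taylor]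
      · rw [degree_taylor]
    · exact (degree_le_natDegree).trans_lt (by exact_mod_cast natDegree_g S _ h2)
    · intro x hx
      rw [eval_sub, taylor_eval, eval_prod, eval_prod, eval_finsetSum,
        Finset.prod_eq_zero hx (by simp), Finset.sum_eq_single x]
      · rw [eval_mul, eval_C, eval_prod, ← Finset.mul_prod_erase S _ hx]
        beta_reduce
        rw [Finset.prod_div_distrib]
        have hne : ∏ b ∈ S.erase x, (x - b) ≠ 0 := by
          rw [Finset.prod_ne_zero_iff]
          intro b hb h
          exact Finset.ne_of_mem_erase hb (sub_eq_zero.mp h).symm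
        simp only [eval_sub, eval_X, eval_C]
        field_simp
        simp only [sub_eq_add_neg]
        ring
      · intro b hb hbx
        rw [eval_mul, eval_prod, Finset.prod_eq_zero (i := x)
          (Finset.mem_erase.mpr ⟨hbx.symm, hx⟩) (by simp), mul_zero]
      · exact fun h => absurd hx h

lemma mesh_le_iff (n : ℕ) (hn : 2 ≤ n) (P : ℝ[X]) (hc : P.roots.card = n) (d : ℝ) (hd : 0 < d) :
    d ≤ mesh n P ↔ P.roots.Nodup ∧ ∀ a ∈ P.roots, ∀ b ∈ P.roots, a < b → d ≤ b - a := by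
  have hlen : (sroots P).length = n := by rw [sroots, Multiset.length_sort, hc]
  have hcoe : ((sroots P : List ℝ) : Multiset ℝ) = P.roots := Multiset.sort_eq _ _
  have hsorted : (sroots P).Pairwise (· ≤ ·) := Multiset.pairwise_sort _ _
  have hget : ∀ k (hk : k < n), (sroots P).getD k 0 = (sroots P)[k]'(by omega) := by
    intro k hk
    rw [List.getD_eq_getElem]
  have hnd : P.roots.Nodup ↔ (sroots P).Nodup := by rw [← hcoe, Multiset.coe_nodup]
  have hmem : ∀ a, a ∈ P.roots ↔ a ∈ sroots P := by intro a; rw [← hcoe, Multiset.mem_coe]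
  unfold mesh
  have hne : {x : ℝ | ∃ k l : ℕ, k < l ∧ l < n ∧
    x = |(sroots P).getD k 0 - (sroots P).getD l 0|}.Nonempty := ⟨_, 0, 1, by omega, by omega, rfl⟩
  rw [le_csInf_iff ⟨0, by rintro _ ⟨k, l, _, _, rfl⟩; exact abs_nonneg _⟩ hne]
  constructor
  · intro h
    have h' : ∀ k l (hkl : k < l) (hl : l < n),
        d ≤ (sroots P)[l]'(by omega) - (sroots P)[k]'(by omega) := by
      intro k l hkl hl
      have := h _ ⟨k, l, hkl, hl, rfl⟩
      rw [hget k (by omega), hget l hl] at this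
      have hle := List.pairwise_iff_getElem.mp hsorted k l (by omega) (by omega) hkl
      rwa [abs_of_nonpos (by linarith), neg_sub] at this
    refine ⟨?_, ?_⟩
    · rw [hnd, List.Nodup, List.pairwise_iff_getElem]
      intro i j hi hj hij he
      have := h' i j hij (by omega)
      rw [he] at this
      linarith
    · intro a ha b hb hab
      rw [hmem] at ha hb
      obtain ⟨i, hi, rfl⟩ := List.getElem_of_mem ha
      obtain ⟨j, hj, rfl⟩ := List.getElem_of_mem hb
      rcases lt_trichotomy i j with hij | hij | hij
      · exact h' i j hij (by omega)
      · subst hij; exact absurd hab (lt_irrefl _)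
      · have := h' j i hij (by omega)
        linarith
  · rintro ⟨h1, h2⟩ _ ⟨k, l, hkl, hl, rfl⟩
    rw [hget k (by omega), hget l hl]
    have hle := List.pairwise_iff_getElem.mp hsorted k l (by omega) (by omega) hkl
    have hne := List.pairwise_iff_getElem.mp (hnd.mp h1) k l (by omega) (by omega) hkl
    have := h2 _ ((hmem _).mpr (List.getElem_mem _)) _ ((hmem _).mpr (List.getElem_mem _))
      (lt_of_le_of_ne hle hne)
    rw [abs_of_nonpos (by linarith), neg_sub]
    exact this


/-- the mesh does not decrease under the additive finite free convolution. -/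
theorem ffAdd_mesh (n : ℕ) (hn : 2 ≤ n) (p q : Polynomial ℝ)
    (hp : RealRooted p) (hq : RealRooted q)
    (hpd : p.natDegree = n) (hqd : q.natDegree = n) :
    mesh n p ≤ mesh n (ffAdd n p q) := by
  have hmesh0 : ∀ P : ℝ[X], 0 ≤ mesh n P := by
    intro P
    apply Real.sInf_nonneg
    rintro _ ⟨k, l, _, _, rfl⟩
    exact abs_nonneg _
  rcases (hmesh0 p).eq_or_lt with h0 | hpos
  · rw [← h0]; exact hmesh0 _
  set d := mesh n p with hd
  have hpc : p.roots.card = n := by rw [← hpd]; exact hp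
  obtain ⟨hnd, hgap⟩ := (mesh_le_iff n hn p hpc d hpos).mp le_rfl
  set S : Finset ℝ := ⟨p.roots, hnd⟩ with hSdef
  have hScard : S.card = n := hpc
  set p0 : ℝ[X] := ∏ a ∈ S, (X - C a) with hp0
  have hp0d : p0.natDegree = n := by
    rw [hp0, natDegree_prod _ _ (fun a _ => X_sub_C_ne_zero a)]; simp [hScard]
  have hlc : p.leadingCoeff ≠ 0 := by
    rw [Ne, leadingCoeff_eq_zero]; rintro rfl; simp at hpd; omega
  have hpp : p = C p.leadingCoeff * p0 := (C_leadingCoeff_mul_prod_multiset_X_sub_C hp).symm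
  have hfac : (n.factorial : ℝ) ≠ 0 := by positivity
  have hPhi := ffAdd_eq_Phi n p q hpd
  have hPrr := Phi_realRooted n q p hq hqd hn hp hpd
  have hPnd := Phi_natDegree n q p hqd hpd hn
  have hroots : (ffAdd n p q).roots = (Phi n q p).roots := by
    rw [← hPhi, roots_C_mul _ hfac]
  have hmeq : mesh n (ffAdd n p q) = mesh n (Phi n q p) := by
    unfold mesh sroots
    rw [hroots]
  rw [hmeq]
  have hroots0 : (Phi n q p).roots = (Phi n q p0).roots := by
    conv_lhs => rw [hpp]
    rw [Phi_C_mul, roots_C_mul _ hlc]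
  have hP0ne : Phi n q p0 ≠ 0 := by
    intro h
    have := Phi_natDegree n q p0 hqd hp0d hn
    rw [h] at this; simp at this; omega
  rw [mesh_le_iff n hn _ (hPrr.trans hPnd) d hpos, hroots0]
  have hg2 : 2 ≤ S.card := by rw [hScard]; exact hn
  constructor
  · rw [Multiset.nodup_iff_count_le_one]
    intro x
    rw [count_roots]
    by_contra hlt
    rw [not_le, one_lt_rootMultiplicity_iff_isRoot hP0ne] at hlt
    have hder : derivative p0 = ∑ a ∈ S, C ((fun _ => (1 : ℝ)) a) * ∏ b ∈ S.erase a, (X - C b) := by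
      rw [hp0, derivative_prod_finset]
      simp
    refine no_common n q hq hqd hn p0 (derivative p0) hp0d ?_ ?_ x hlt.1 ?_
    · rw [hder, ← hScard]; exact natDegree_g S _ hg2
    · rw [hder]; exact stable S _ (fun _ _ => one_pos)
    · rw [Phi_derivative]; exact hlt.2
  · intro a ha b hb hab
    by_contra hlt
    rw [not_le] at hlt
    obtain ⟨c, hc, hce⟩ := diff_eq S d (b - a) (by linarith) hlt hg2 (by
      intro x hx y hy hxy
      rcases lt_or_gt_of_ne hxy with h | h
      · rw [abs_sub_comm, abs_of_pos (by linarith)]; exact hgap x hx y hy h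
      · rw [abs_of_pos (by linarith)]; exact hgap y hy x hx h)
    have hb0 : (Phi n q p0).eval b = 0 := isRoot_of_mem_roots hb
    have ha0 : (Phi n q p0).eval a = 0 := isRoot_of_mem_roots ha
    refine no_common n q hq hqd hn p0 (p0 - taylor (-(b - a)) p0) hp0d ?_ ?_ b hb0 ?_
    · rw [hce, ← hScard]; exact natDegree_g S _ hg2
    · rw [hce]; exact stable S _ hc
    · have e : p0 - taylor (-(b - a)) p0 = p0 + C (-1) * taylor (-(b - a)) p0 := by
        simp [sub_eq_add_neg]
      rw [e, Phi_add, Phi_C_mul, Phi_taylor, eval_add, eval_mul, taylor_eval, hb0,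
        show b + -(b - a) = a by ring, ha0]
      simp
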